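/- For every constant C ∈ ℕ there exists c > 0 such that the following holds. Let m ≥ 1 and let S₀,…,S_m be disjoint subsets of ℤ² with #S_j ≤ 2^j. Let j⃗ = (j₁,j₂,j₃,j₄) ∈ {0,…,m}⁴ and a⃗ = (a₁,a₂,a₃,a₄) ∈ ℕ⁴ with 1 ≤ a₁ < j₁/2 + C. Then #𝒬⁰(j⃗,a⃗) ≤ c · 2^{2j₁ − 2a₁ + a₂ + a₃}. -/

import Mathlib

open scoped BigOperators

noncomputable section

/-- Points of the integer lattice `ℤ²`. -/
abbrev Pt := ℤ × ℤ

/-- A quadruple of lattice points, viewed as a function on `Fin 4`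
(indices taken cyclically). -/
abbrev Quad := Fin 4 → Pt

/-- The embedding `ℤ² ↪ ℝ²`. -/
def emb (ξ : Pt) : ℝ × ℝ := ((ξ.1 : ℝ), (ξ.2 : ℝ))

/-- An affine line in the plane `ℝ²`. -/
def IsLine (ℓ : Set (ℝ × ℝ)) : Prop :=
  ∃ p v : ℝ × ℝ, v ≠ 0 ∧ ℓ = {x | ∃ t : ℝ, x = p + t • v}

/-- The line through two lattice points `p ≠ q` (a degenerate point if `p = q`). -/
def lineThrough (p q : Pt) : Set (ℝ × ℝ) :=
  {x | ∃ t : ℝ, x = emb p + t • (emb q - emb p)}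

/-- The number of points of a finite set `T ⊂ ℤ²` on a set `ℓ ⊂ ℝ²`,
i.e. `#(ℓ ∩ T)`. -/
def lineCount (ℓ : Set (ℝ × ℝ)) (T : Finset Pt) : ℕ :=
  (ℓ ∩ (emb '' (T : Set Pt))).ncard

/-- `Q = (ξ₁,ξ₂,ξ₃,ξ₄)` is a parallelogram: `ξ₁ + ξ₃ = ξ₂ + ξ₄`. -/
def IsPara (Q : Quad) : Prop := Q 0 + Q 2 = Q 1 + Q 3

/-- The dot product `(ξ₁ − ξ₂)·(ξ₁ − ξ₄)`. -/
def dotQ (Q : Quad) : ℤ :=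
  ((Q 0).1 - (Q 1).1) * ((Q 0).1 - (Q 3).1) + ((Q 0).2 - (Q 1).2) * ((Q 0).2 - (Q 3).2)

/-- `τ_Q = ||ξ₁|² − |ξ₂|² + |ξ₃|² − |ξ₄|²| = 2|(ξ₁−ξ₂)·(ξ₁−ξ₄)|`. -/
def tauQ (Q : Quad) : ℤ := 2 * |dotQ Q|

/-- `Q` is a rectangle: a parallelogram with `τ_Q = 0`. Membership in `𝒬⁰`. -/
def IsRect (Q : Quad) : Prop := IsPara Q ∧ dotQ Q = 0

/-- `f(Q) = f(ξ₁)f(ξ₂)f(ξ₃)f(ξ₄)`. -/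
def fQ (f : Pt → ℝ) (Q : Quad) : ℝ := ∏ k : Fin 4, f (Q k)

/-- The weight `f = ∑_{j=0}^m λ_j 2^{−j/2} χ_{S_j}`. -/
def fWt (S : ℕ → Finset Pt) (lam : ℕ → ℝ) (m : ℕ) (ξ : Pt) : ℝ :=
  ∑ j ∈ Finset.range (m + 1), if ξ ∈ S j then lam j * (2 : ℝ) ^ (-(j : ℝ) / 2) else 0

/-- `gcd((a,b)) = gcd(|a|,|b|)` for `(a,b) ∈ ℤ²`. -/
def gcdP (ξ : Pt) : ℕ := Int.gcd ξ.1 ξ.2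

/-- `max{#(ℓ(ξ,η₁) ∩ S_j), #(ℓ(ξ,η₂) ∩ S_j)}`, where `η₁, η₂` are the two
neighboring vertices of `ξ` in a rectangle. -/
def crossMax (S : ℕ → Finset Pt) (j : ℕ) (ξ η₁ η₂ : Pt) : ℕ :=
  max (lineCount (lineThrough ξ η₁) (S j)) (lineCount (lineThrough ξ η₂) (S j))

/-- `ξ` lies in some `S_j`, `j ≤ m`, and is a vertex of type `α ∈ {1,2,3}`
relative to its neighbors `η₁, η₂`: with `a := log₂ crossMax`, type 1 means
`a ≥ j/2 + C` (i.e. `crossMax ≥ 2^{j/2+C}`), type 2 means `1 ≤ a < j/2 + C`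
(i.e. `2 ≤ crossMax < 2^{j/2+C}`), and type 3 means `a = 0` (`crossMax = 1`). -/
def VertexType (S : ℕ → Finset Pt) (C m : ℕ) (α : ℕ) (ξ η₁ η₂ : Pt) : Prop :=
  ∃ j ≤ m, ξ ∈ S j ∧
    ((α = 1 ∧ (2 : ℝ) ^ ((j : ℝ) / 2 + (C : ℝ)) ≤ (crossMax S j ξ η₁ η₂ : ℝ)) ∨
     (α = 2 ∧ 2 ≤ crossMax S j ξ η₁ η₂ ∧
        (crossMax S j ξ η₁ η₂ : ℝ) < (2 : ℝ) ^ ((j : ℝ) / 2 + (C : ℝ))) ∨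
     (α = 3 ∧ crossMax S j ξ η₁ η₂ = 1))

/-- The set `𝒬⁰_{α,β}`: rectangles with four distinct vertices, all in
`∪_{j=0}^m S_j`, with `ξ₁, ξ₂` of type `α` and `ξ₃, ξ₄` of type `β`. -/
def QZeroAB (S : ℕ → Finset Pt) (C m : ℕ) (α β : ℕ) : Set Quad :=
  {Q | IsRect Q ∧ Function.Injective Q ∧
    VertexType S C m α (Q 0) (Q 1) (Q 3) ∧
    VertexType S C m α (Q 1) (Q 2) (Q 0) ∧
    VertexType S C m β (Q 2) (Q 3) (Q 1) ∧
    VertexType S C m β (Q 3) (Q 0) (Q 2)}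

/-- The set `𝒬⁰(j⃗, a⃗)`: rectangles with distinct vertices `ξ_k ∈ S_{j_k}` such
that for each `k` (cyclically), `2^{a_k} ≤ max{#(ℓ(ξ_k,ξ_{k+1}) ∩ S_{j_k}),
#(ℓ(ξ_k,ξ_{k−1}) ∩ S_{j_k})} < 2^{a_k+1}`. -/
def QZeroJA (S : ℕ → Finset Pt) (j a : Fin 4 → ℕ) : Set Quad :=
  {Q | IsRect Q ∧ Function.Injective Q ∧ (∀ k, Q k ∈ S (j k)) ∧
    ∀ k : Fin 4,
      2 ^ (a k) ≤ max (lineCount (lineThrough (Q k) (Q (k + 1))) (S (j k)))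
          (lineCount (lineThrough (Q k) (Q (k - 1))) (S (j k))) ∧
        max (lineCount (lineThrough (Q k) (Q (k + 1))) (S (j k)))
          (lineCount (lineThrough (Q k) (Q (k - 1))) (S (j k))) < 2 ^ (a k + 1)}


/-! ### A Szemerédi–Trotter incidence bound

The points are elements of a type `V` with coordinates `X Y : V → ℝ`, the first of which is
injective, so that every line through two points is the graph of an affine function. -/

section Incidence

open Classical in
/-- Weighted count over the subsets of `P`: a set `A ⊆ P` is contained in a `p`-random subset
of `P` with probability `p ^ #A`. -/
lemma sum_powerset_weight {V : Type*} (P A : Finset V) (hA : A ⊆ P) (p : ℝ) :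
    ∑ T ∈ P.powerset, p ^ T.card * (1 - p) ^ (P \ T).card * (if A ⊆ T then 1 else 0)
      = p ^ A.card := by
  have h := Finset.prod_add (fun _ : V => p) (fun i => if i ∈ A then 0 else 1 - p) P
  have h1 : ∏ i ∈ P, (p + (if i ∈ A then 0 else 1 - p)) = p ^ A.card := by
    rw [← Finset.prod_subset hA, ← Finset.prod_const]
    · exact Finset.prod_congr rfl fun i hi => by simp [hi]
    · intro i _ hi
      simp [hi]
  rw [← h1, h]
  refine Finset.sum_congr rfl fun T _ => ?_
  rw [Finset.prod_const, mul_assoc]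
  congr 1
  by_cases hAT : A ⊆ T
  · rw [if_pos hAT, mul_one, ← Finset.prod_const]
    refine Finset.prod_congr rfl fun i hi => ?_
    rw [if_neg fun hiA => (Finset.mem_sdiff.1 hi).2 (hAT hiA)]
  · rw [if_neg hAT, mul_zero]
    obtain ⟨i, hiA, hiT⟩ := Finset.not_subset.1 hAT
    exact (Finset.prod_eq_zero (Finset.mem_sdiff.2 ⟨hA hiA, hiT⟩) (by simp [hiA])).symm

open Classical in
/-- The expected number of members of a family of `d`-element subsets of `P` that are contained
in a `p`-random subset of `P`. -/
lemma sum_powerset_weight_card {V ι : Type*} (P : Finset V) (s : Finset ι) (g : ι → Finset V)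
    (d : ℕ) (hg : ∀ i ∈ s, g i ⊆ P) (hd : ∀ i ∈ s, (g i).card = d) (p : ℝ) :
    ∑ T ∈ P.powerset, p ^ T.card * (1 - p) ^ (P \ T).card * ((s.filter (g · ⊆ T)).card : ℝ)
      = s.card * p ^ d := by
  simp_rw [Finset.card_filter, Nat.cast_sum, Finset.mul_sum]
  rw [Finset.sum_comm]
  have : ∀ i ∈ s, ∑ T ∈ P.powerset, p ^ T.card * (1 - p) ^ (P \ T).card *
      (((if g i ⊆ T then 1 else 0 : ℕ)) : ℝ) = p ^ d := by
    intro i hi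
    rw [← hd i hi, ← sum_powerset_weight P (g i) (hg i hi) p]
    simp
  rw [Finset.sum_congr rfl this, Finset.sum_const, nsmul_eq_mul]

variable {V : Type*} (X Y : V → ℝ)

/-- The slope of the segment `e`. -/
def segSlope (e : V × V) : ℝ := (Y e.2 - Y e.1) / (X e.2 - X e.1)

/-- The affine function whose graph is the line through the endpoints of `e`. -/
def segVal (e : V × V) (x : ℝ) : ℝ := Y e.1 + segSlope X Y e * (x - X e.1)

/-- The segments `e` and `f` cross: over the intersection of their shadows, each one is strictly
below the other somewhere. -/
def SegCross (e f : V × V) : Prop :=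
  ∃ x₁ x₂, (X e.1 ≤ x₁ ∧ x₁ ≤ X e.2) ∧ (X f.1 ≤ x₁ ∧ x₁ ≤ X f.2) ∧
    (X e.1 ≤ x₂ ∧ x₂ ≤ X e.2) ∧ (X f.1 ≤ x₂ ∧ x₂ ≤ X f.2) ∧
    segVal X Y e x₁ < segVal X Y f x₁ ∧ segVal X Y f x₂ < segVal X Y e x₂

variable {X Y}

lemma segVal_fst (e : V × V) : segVal X Y e (X e.1) = Y e.1 := by simp [segVal]

lemma segVal_snd {e : V × V} (h : X e.1 ≠ X e.2) : segVal X Y e (X e.2) = Y e.2 := by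
  have : X e.2 - X e.1 ≠ 0 := sub_ne_zero.2 h.symm
  simp only [segVal, segSlope]
  field_simp
  ring

lemma segVal_eq_of_mem {e f : V × V} (h : X e.1 ≠ X e.2) (h1 : segVal X Y f (X e.1) = Y e.1)
    (h2 : segVal X Y f (X e.2) = Y e.2) : segVal X Y e = segVal X Y f := by
  have h0 : X e.2 - X e.1 ≠ 0 := sub_ne_zero.2 h.symm
  have hs : segSlope X Y e = segSlope X Y f := by
    rw [segSlope, div_eq_iff h0, ← h1, ← h2]
    simp only [segVal]
    ring
  funext x
  have : segVal X Y e x = Y e.1 + segSlope X Y e * (x - X e.1) := rfl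
  rw [this, hs, ← h1]
  simp only [segVal]
  ring

/-- Two segments that share an endpoint do not cross. -/
lemma SegCross.endpoints_ne {e f : V × V} (he : X e.1 < X e.2) (hf : X f.1 < X f.2)
    (h : SegCross X Y e f) : e.1 ≠ f.1 ∧ e.2 ≠ f.2 ∧ e.1 ≠ f.2 ∧ e.2 ≠ f.1 := by
  obtain ⟨x₁, x₂, ⟨a1, a2⟩, ⟨a3, a4⟩, ⟨b1, b2⟩, ⟨b3, b4⟩, h1, h2⟩ := h
  refine ⟨fun h => ?_, fun h => ?_, fun h => ?_, fun h => ?_⟩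
  · simp only [segVal, ← h] at h1 h2
    rcases le_total (segSlope X Y e) (segSlope X Y f) with hs | hs
    · nlinarith [mul_nonneg (sub_nonneg.2 hs) (sub_nonneg.2 b1)]
    · nlinarith [mul_nonneg (sub_nonneg.2 hs) (sub_nonneg.2 a1)]
  · have key : ∀ x, segVal X Y e x - segVal X Y f x =
        (segSlope X Y e - segSlope X Y f) * (x - X e.2) := by
      intro x
      have e1 := segVal_snd (Y := Y) he.ne
      have e2 := segVal_snd (Y := Y) hf.ne
      rw [← h] at e2
      simp only [segVal] at *
      linear_combination e1 - e2
    have k1 := key x₁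
    have k2 := key x₂
    rcases le_total (segSlope X Y e) (segSlope X Y f) with hs | hs
    · nlinarith [mul_nonneg (sub_nonneg.2 hs) (sub_nonneg.2 a2)]
    · nlinarith [mul_nonneg (sub_nonneg.2 hs) (sub_nonneg.2 b2)]
  · rw [← h] at a4 b4
    rw [le_antisymm a4 a1] at h1
    rw [le_antisymm b4 b1] at h2
    exact lt_asymm h1 h2
  · rw [← h] at a3 b3
    rw [le_antisymm a2 a3] at h1
    rw [le_antisymm b2 b3] at h2
    exact lt_asymm h1 h2

variable (X Y) in
/-- `E` is a set of segments with endpoints in `P`, directed to the right, whose interiors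
contain no point of `P`. -/
def IsSegGraph (P : Finset V) (E : Finset (V × V)) : Prop :=
  ∀ e ∈ E, e.1 ∈ P ∧ e.2 ∈ P ∧ X e.1 < X e.2 ∧
    ∀ r ∈ P, X e.1 < X r → X r < X e.2 → segVal X Y e (X r) ≠ Y r

variable (X Y) in
/-- `w` is the leftmost point of `P` in the wedge between the segments `e` and `f`, where `f` is
above `e` and both have the same left endpoint. -/
structure IsWedge (P : Finset V) (e f : V × V) (w : V) : Prop where
  fst_eq : f.1 = e.1
  slope_lt : segSlope X Y e < segSlope X Y f
  lt : X e.1 < X w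
  le_left : X w ≤ X e.2
  le_right : X w ≤ X f.2
  ge : segVal X Y e (X w) ≤ Y w
  le : Y w ≤ segVal X Y f (X w)
  first : ∀ r ∈ P, X e.1 < X r → X r < X w → segVal X Y e (X r) ≤ Y r →
    segVal X Y f (X r) < Y r

lemma segVal_lt_of_slope_lt {e f : V × V} (h : f.1 = e.1)
    (hs : segSlope X Y e < segSlope X Y f) {x : ℝ} (hx : X e.1 < x) :
    segVal X Y e x < segVal X Y f x := by
  simp only [segVal, h]
  nlinarith

lemma segVal_le_of_slope_le {e f : V × V} (h : f.1 = e.1)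
    (hs : segSlope X Y e ≤ segSlope X Y f) {x : ℝ} (hx : X e.1 < x) :
    segVal X Y e x ≤ segVal X Y f x := by
  simp only [segVal, h]
  nlinarith

/-- In a plane graph, wedges with the same leftmost point on the same side start at the same
vertex. -/
lemma IsWedge.not_lt {P : Finset V} {e f e' f' : V × V} {w : V}
    (h : IsWedge X Y P e f w) (h' : IsWedge X Y P e' f' w) (hP : e'.1 ∈ P)
    (hc1 : ¬ SegCross X Y e' f) (hc2 : ¬ SegCross X Y e f')
    (hs : (segVal X Y e (X w) < Y w ∧ segVal X Y e' (X w) < Y w) ∨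
      (Y w < segVal X Y f (X w) ∧ Y w < segVal X Y f' (X w))) :
    ¬ X e.1 < X e'.1 := by
  intro hlt
  have h1 := h.le_left
  have h2 := h.le_right
  have h3 := h'.le_left
  have h4 := h'.le_right
  have h5 := h'.lt
  have h6 := h.le
  have h7 := h.ge
  have h8 := h'.le
  have h9 := h'.ge
  by_cases hb : segVal X Y e (X e'.1) ≤ Y e'.1
  · have := h.first _ hP hlt h'.lt hb
    refine hc1 ⟨X w, X e'.1, ⟨h5.le, h3⟩, ⟨?_, h2⟩, ⟨le_rfl, h5.le.trans h3⟩, ⟨?_, ?_⟩, ?_, ?_⟩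
    · rw [h.fst_eq]; exact h.lt.le
    · rw [h.fst_eq]; exact hlt.le
    · linarith
    · rcases hs with hs | hs <;> linarith
    · rwa [segVal_fst]
  · push Not at hb
    refine hc2 ⟨X w, X e'.1, ⟨h.lt.le, h1⟩, ⟨?_, h4⟩, ⟨hlt.le, h5.le.trans h1⟩, ⟨?_, ?_⟩, ?_, ?_⟩
    · rw [h'.fst_eq]; exact h5.le
    · rw [h'.fst_eq]
    · linarith
    · rcases hs with hs | hs <;> linarith
    · rw [← h'.fst_eq, segVal_fst, h'.fst_eq]; exact hb

lemma IsSegGraph.eq_of_slope_eq {P : Finset V} {E : Finset (V × V)} (hX : Function.Injective X)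
    (hE : IsSegGraph X Y P E) {e f : V × V} (he : e ∈ E) (hf : f ∈ E) (h : e.1 = f.1)
    (hs : segSlope X Y e = segSlope X Y f) : e = f := by
  have hv : segVal X Y e = segVal X Y f := by
    funext x
    simp only [segVal, h, hs]
  obtain ⟨_, e2, e3, e4⟩ := hE e he
  obtain ⟨_, f2, f3, f4⟩ := hE f hf
  refine Prod.ext h (hX ?_)
  rcases lt_trichotomy (X e.2) (X f.2) with hlt | heq | hgt
  · refine absurd ?_ (f4 e.2 e2 (h ▸ e3) hlt)
    rw [← hv, segVal_snd e3.ne]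
  · exact heq
  · refine absurd ?_ (e4 f.2 f2 (h ▸ f3) hgt)
    rw [hv, segVal_snd f3.ne]

/-- A segment that is not the topmost one at its left endpoint is the lower side of a wedge. -/
lemma IsSegGraph.exists_wedge {P : Finset V} {E : Finset (V × V)}
    (hE : IsSegGraph X Y P E) {e g : V × V} (he : e ∈ E) (hg : g ∈ E) (h : g.1 = e.1)
    (hs : segSlope X Y e < segSlope X Y g) :
    ∃ f ∈ E, ∃ w ∈ P, IsWedge X Y P e f w ∧
      ∀ f' ∈ E, f'.1 = e.1 → segSlope X Y e < segSlope X Y f' →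
        segSlope X Y f ≤ segSlope X Y f' := by
  classical
  obtain ⟨f, hf, hmin⟩ := Finset.exists_min_image
    (E.filter fun f => f.1 = e.1 ∧ segSlope X Y e < segSlope X Y f) (segSlope X Y)
    ⟨g, by simp [hg, h, hs]⟩
  simp only [Finset.mem_filter] at hf hmin
  obtain ⟨hfE, hf1, hfs⟩ := hf
  obtain ⟨_, e2, e3, _⟩ := hE e he
  obtain ⟨_, f2, f3, _⟩ := hE f hfE
  have hne : (P.filter fun w => X e.1 < X w ∧ X w ≤ X e.2 ∧ X w ≤ X f.2 ∧
      segVal X Y e (X w) ≤ Y w ∧ Y w ≤ segVal X Y f (X w)).Nonempty := by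
    rcases le_total (X e.2) (X f.2) with hle | hle
    · refine ⟨e.2, ?_⟩
      simp only [Finset.mem_filter]
      refine ⟨e2, e3, le_rfl, hle, (segVal_snd e3.ne).le, ?_⟩
      rw [← segVal_snd (Y := Y) e3.ne]
      exact (segVal_lt_of_slope_lt hf1 hfs e3).le
    · refine ⟨f.2, ?_⟩
      simp only [Finset.mem_filter]
      refine ⟨f2, hf1 ▸ f3, hle, le_rfl, ?_, (segVal_snd f3.ne).ge⟩
      rw [← segVal_snd (Y := Y) f3.ne]
      exact (segVal_lt_of_slope_lt hf1 hfs (hf1 ▸ f3)).le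
  obtain ⟨w, hw, hwmin⟩ := Finset.exists_min_image _ X hne
  simp only [Finset.mem_filter] at hw hwmin
  obtain ⟨hwP, w1, w2, w3, w4, w5⟩ := hw
  refine ⟨f, hfE, w, hwP, ⟨hf1, hfs, w1, w2, w3, w4, w5, fun r hr r1 r2 r3 => ?_⟩,
    fun f' hf' h1 h2 => hmin f' ⟨hf', h1, h2⟩⟩
  by_contra hcon
  push Not at hcon
  exact absurd (hwmin r ⟨hr, r1, r2.le.trans w2, r2.le.trans w3, r3, hcon⟩) (not_le.2 r2)

/-- A plane geometric graph on `n` vertices has at most `3 n` edges. -/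
lemma IsSegGraph.card_le_of_not_cross {P : Finset V} {E : Finset (V × V)}
    (hX : Function.Injective X) (hE : IsSegGraph X Y P E)
    (hc : ∀ e ∈ E, ∀ f ∈ E, ¬ SegCross X Y e f) : E.card ≤ 3 * P.card := by
  classical
  let top : V × V → Prop := fun e => ∀ f ∈ E, f.1 = e.1 → segSlope X Y f ≤ segSlope X Y e
  have htop : (E.filter top).card ≤ P.card := by
    refine Finset.card_le_card_of_injOn Prod.fst
      (fun e he => (hE e (Finset.mem_filter.1 he).1).1) fun e he f hf hef => ?_
    rw [Finset.mem_coe, Finset.mem_filter] at he hf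
    exact hE.eq_of_slope_eq hX he.1 hf.1 hef
      (le_antisymm (hf.2 e he.1 hef) (he.2 f hf.1 hef.symm))
  have hwedge : ∀ e : V × V, ∃ fw : (V × V) × V, e ∈ E → ¬ top e →
      fw.1 ∈ E ∧ fw.2 ∈ P ∧ IsWedge X Y P e fw.1 fw.2 ∧
      ∀ f' ∈ E, f'.1 = e.1 → segSlope X Y e < segSlope X Y f' →
        segSlope X Y fw.1 ≤ segSlope X Y f' := by
    intro e
    by_cases h : e ∈ E ∧ ¬ top e
    · obtain ⟨he, ht⟩ := h
      simp only [top, not_forall, not_le] at ht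
      obtain ⟨g, hg, h1, h2⟩ := ht
      obtain ⟨f, hf, w, hw, hfw⟩ := hE.exists_wedge he hg h1 h2
      exact ⟨(f, w), fun _ _ => ⟨hf, hw, hfw⟩⟩
    · exact ⟨(e, e.1), fun h1 h2 => absurd ⟨h1, h2⟩ h⟩
  choose W hW using hwedge
  have hnon : (E.filter fun e => ¬ top e).card ≤ (P ×ˢ (Finset.univ : Finset Bool)).card := by
    refine Finset.card_le_card_of_injOn (fun e => ((W e).2, decide ((W e).2 = (W e).1.2)))
      (fun e he => ?_) fun e he e' he' hee => ?_
    · rw [Finset.mem_coe, Finset.mem_filter] at he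
      exact Finset.mem_product.2 ⟨(hW e he.1 he.2).2.1, Finset.mem_univ _⟩
    rw [Finset.mem_coe, Finset.mem_filter] at he he'
    obtain ⟨hf, hw, hwd, hnext⟩ := hW e he.1 he.2
    obtain ⟨hf', hw', hwd', hnext'⟩ := hW e' he'.1 he'.2
    simp only [Prod.mk.injEq, decide_eq_decide] at hee
    obtain ⟨hww, hcl⟩ := hee
    rw [← hww] at hwd' hcl
    generalize (W e).2 = w at *
    generalize (W e).1 = f at *
    generalize (W e').1 = f' at *
    have hs : (segVal X Y e (X w) < Y w ∧ segVal X Y e' (X w) < Y w) ∨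
        (Y w < segVal X Y f (X w) ∧ Y w < segVal X Y f' (X w)) := by
      by_cases hwf : w = f.2
      · left
        have hwf' := hcl.1 hwf
        have a1 := segVal_snd (Y := Y) (hE f hf).2.2.1.ne
        have a2 := segVal_snd (Y := Y) (hE f' hf').2.2.1.ne
        rw [← hwf] at a1
        rw [← hwf'] at a2
        exact ⟨(segVal_lt_of_slope_lt hwd.fst_eq hwd.slope_lt hwd.lt).trans_eq a1,
          (segVal_lt_of_slope_lt hwd'.fst_eq hwd'.slope_lt hwd'.lt).trans_eq a2⟩
      · right
        have hwf' := fun h => hwf (hcl.2 h)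
        refine ⟨hwd.le.lt_of_ne fun h => ?_, hwd'.le.lt_of_ne fun h => ?_⟩
        · exact (hE f hf).2.2.2 w hw (hwd.fst_eq ▸ hwd.lt)
            (hwd.le_right.lt_of_ne fun h => hwf (hX h)) h.symm
        · exact (hE f' hf').2.2.2 w hw (hwd'.fst_eq ▸ hwd'.lt)
            (hwd'.le_right.lt_of_ne fun h => hwf' (hX h)) h.symm
    have hfst : e.1 = e'.1 := by
      apply hX
      rcases lt_trichotomy (X e.1) (X e'.1) with hlt | heq | hgt
      · exact absurd hlt (hwd.not_lt hwd' (hE e' he'.1).1 (hc _ he'.1 _ hf) (hc _ he.1 _ hf') hs)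
      · exact heq
      · exact absurd hgt (hwd'.not_lt hwd (hE e he.1).1 (hc _ he.1 _ hf') (hc _ he'.1 _ hf)
          (hs.imp And.symm And.symm))
    have b1 := hwd.ge
    have b2 := hwd.le
    have b3 := hwd'.ge
    have b4 := hwd'.le
    refine hE.eq_of_slope_eq hX he.1 he'.1 hfst ?_
    rcases lt_trichotomy (segSlope X Y e) (segSlope X Y e') with hlt | heq | hgt
    · have := segVal_le_of_slope_le (hfst.symm.trans hwd.fst_eq.symm)
        (hnext e' he'.1 hfst.symm hlt) (hwd.fst_eq ▸ hwd.lt)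
      rcases hs with hs | hs <;> linarith
    · exact heq
    · have := segVal_le_of_slope_le (hfst.trans hwd'.fst_eq.symm)
        (hnext' e he.1 hfst hgt) (hwd'.fst_eq ▸ hwd'.lt)
      rcases hs with hs | hs <;> linarith
  have hsum := Finset.card_filter_add_card_filter_not (s := E) top
  simp only [Finset.card_product, Finset.card_univ, Fintype.card_bool] at hnon
  omega

lemma IsSegGraph.mono {P : Finset V} {E F : Finset (V × V)} (hE : IsSegGraph X Y P E)
    (h : F ⊆ E) : IsSegGraph X Y P F := fun e he => hE e (h he)

open Classical in
variable (X Y) in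
/-- The pairs of crossing segments. -/
def crossPairs (E : Finset (V × V)) : Finset ((V × V) × (V × V)) :=
  (E ×ˢ E).filter fun z => SegCross X Y z.1 z.2

/-- A geometric graph with `n` vertices and `e` edges has at least `e - 3 n` crossings. -/
lemma IsSegGraph.card_le_add_crossPairs {P : Finset V} (hX : Function.Injective X) :
    ∀ {E : Finset (V × V)}, IsSegGraph X Y P E →
      E.card ≤ 3 * P.card + (crossPairs X Y E).card := by
  classical
  intro E
  induction E using Finset.strongInduction with
  | H E ih =>
    intro hE
    by_cases hc : ∀ e ∈ E, ∀ f ∈ E, ¬ SegCross X Y e f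
    · exact (hE.card_le_of_not_cross hX hc).trans (Nat.le_add_right _ _)
    push Not at hc
    obtain ⟨e, he, f, hf, hcr⟩ := hc
    have h1 := ih (E.erase e) (Finset.erase_ssubset he) (hE.mono (Finset.erase_subset _ _))
    rw [Finset.card_erase_of_mem he] at h1
    have h2 : (crossPairs X Y (E.erase e)).card < (crossPairs X Y E).card := by
      refine Finset.card_lt_card (Finset.ssubset_iff_of_subset ?_ |>.2 ⟨(e, f), ?_, ?_⟩)
      · exact Finset.filter_subset_filter _
          (Finset.product_subset_product (Finset.erase_subset _ _) (Finset.erase_subset _ _))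
      · simp [crossPairs, he, hf, hcr]
      · simp [crossPairs]
    omega

/-- The crossing inequality before the choice of the sampling probability. -/
lemma IsSegGraph.sampling {P : Finset V} {E : Finset (V × V)} (hX : Function.Injective X)
    (hE : IsSegGraph X Y P E) {p : ℝ} (hp0 : 0 ≤ p) (hp1 : p ≤ 1) :
    E.card * p ^ 2 ≤ 3 * (P.card * p) + (crossPairs X Y E).card * p ^ 4 := by
  classical
  have hP := sum_powerset_weight_card P P (fun v => {v}) 1
    (fun v hv => by simpa using hv) (fun v hv => by simp) p
  rw [pow_one, eq_comm] at hP
  rw [← sum_powerset_weight_card P E (fun e => {e.1, e.2}) 2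
      (fun e he => ?_) (fun e he => ?_) p,
    ← sum_powerset_weight_card P (crossPairs X Y E)
      (fun z => {z.1.1, z.1.2, z.2.1, z.2.2}) 4 (fun z hz => ?_) (fun z hz => ?_) p,
    hP, Finset.mul_sum, ← Finset.sum_add_distrib]
  · refine Finset.sum_le_sum fun T hT => ?_
    have hT := Finset.mem_powerset.1 hT
    have hw : 0 ≤ p ^ T.card * (1 - p) ^ (P \ T).card :=
      mul_nonneg (pow_nonneg hp0 _) (pow_nonneg (sub_nonneg.2 hp1) _)
    have hsub : IsSegGraph X Y T (E.filter fun e => {e.1, e.2} ⊆ T) := by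
      intro e he
      simp only [Finset.mem_filter, Finset.insert_subset_iff, Finset.singleton_subset_iff] at he
      obtain ⟨_, _, h3, h4⟩ := hE e he.1
      exact ⟨he.2.1, he.2.2, h3, fun r hr => h4 r (hT hr)⟩
    have h1 := hsub.card_le_add_crossPairs hX
    have h2 : (crossPairs X Y (E.filter fun e => {e.1, e.2} ⊆ T)).card ≤
        ((crossPairs X Y E).filter fun z => {z.1.1, z.1.2, z.2.1, z.2.2} ⊆ T).card := by
      refine Finset.card_le_card fun z hz => ?_
      simp only [crossPairs, Finset.mem_filter, Finset.mem_product, Finset.insert_subset_iff,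
        Finset.singleton_subset_iff] at hz ⊢
      tauto
    have h3 : (P.filter fun v => {v} ⊆ T).card = T.card := by
      congr 1
      ext v
      simp only [Finset.mem_filter, Finset.singleton_subset_iff]
      exact ⟨fun h => h.2, fun h => ⟨hT h, h⟩⟩
    rw [h3]
    have h4 : ((E.filter fun e => {e.1, e.2} ⊆ T).card : ℝ) ≤ 3 * T.card +
        ((crossPairs X Y E).filter fun z => {z.1.1, z.1.2, z.2.1, z.2.2} ⊆ T).card := by
      exact_mod_cast h1.trans (Nat.add_le_add_left h2 _)
    calc _ ≤ _ := mul_le_mul_of_nonneg_left h4 hw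
      _ = _ := by ring
  · simp only [crossPairs, Finset.mem_filter, Finset.mem_product] at hz
    obtain ⟨a1, a2, _⟩ := hE _ hz.1.1
    obtain ⟨b1, b2, _⟩ := hE _ hz.1.2
    simp [Finset.insert_subset_iff, a1, a2, b1, b2]
  · simp only [crossPairs, Finset.mem_filter, Finset.mem_product] at hz
    have a := (hE _ hz.1.1).2.2.1
    have b := (hE _ hz.1.2).2.2.1
    obtain ⟨h1, h2, h3, h4⟩ := hz.2.endpoints_ne a b
    have a' : z.1.1 ≠ z.1.2 := fun h => a.ne (congrArg X h)
    have b' : z.2.1 ≠ z.2.2 := fun h => b.ne (congrArg X h)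
    simp [h1, h2, h3, h4, a', b']
  · obtain ⟨a1, a2, _⟩ := hE e he
    simp [Finset.insert_subset_iff, a1, a2]
  · exact Finset.card_pair fun h => (hE e he).2.2.1.ne (congrArg X h)

/-- The crossing inequality. -/
lemma IsSegGraph.crossing_inequality {P : Finset V} {E : Finset (V × V)}
    (hX : Function.Injective X) (hE : IsSegGraph X Y P E) {N : ℝ} (hN : (P.card : ℝ) ≤ N)
    (hN0 : 0 < N) (h : 6 * N < E.card) :
    (E.card : ℝ) ^ 3 ≤ 72 * N ^ 2 * (crossPairs X Y E).card := by
  set e : ℝ := (E.card : ℝ)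
  set x : ℝ := ((crossPairs X Y E).card : ℝ)
  have he : 0 < e := by linarith
  have hs := hE.sampling hX (p := 6 * N / e) (by positivity) ((div_le_one he).2 h.le)
  have h1 : e * (6 * N / e) ^ 2 ≤ 3 * (N * (6 * N / e)) + x * (6 * N / e) ^ 4 :=
    hs.trans (by gcongr)
  have h2 : 18 * N ^ 2 / e ≤ x * (1296 * N ^ 4 / e ^ 4) := by
    have e1 : e * (6 * N / e) ^ 2 = 36 * N ^ 2 / e := by field_simp; ring
    have e2 : 3 * (N * (6 * N / e)) = 18 * N ^ 2 / e := by field_simp; ring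
    have e3 : (6 * N / e) ^ 4 = 1296 * N ^ 4 / e ^ 4 := by field_simp; ring
    have e4 : 36 * N ^ 2 / e = 18 * N ^ 2 / e + 18 * N ^ 2 / e := by ring
    rw [e1, e2, e3, e4] at h1
    linarith
  have h3 : 18 * N ^ 2 * e ^ 3 ≤ 18 * N ^ 2 * (72 * N ^ 2 * x) := by
    calc 18 * N ^ 2 * e ^ 3 = 18 * N ^ 2 / e * e ^ 4 := by field_simp
      _ ≤ x * (1296 * N ^ 4 / e ^ 4) * e ^ 4 := by gcongr
      _ = _ := by field_simp; ring
  exact le_of_mul_le_mul_left h3 (by positivity)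

open Classical in
variable (X Y) in
/-- The points of `P` on the line through the endpoints of `e`. -/
def lineTrace (P : Finset V) (e : V × V) : Finset V :=
  P.filter fun r => segVal X Y e (X r) = Y r

open Classical in
variable (X Y) in
/-- The intersections of `P` with the lines containing at least `k` points of `P`. -/
def richTraces (P : Finset V) (k : ℕ) : Finset (Finset V) :=
  (P.offDiag.image (lineTrace X Y P)).filter fun t => k ≤ t.card

lemma lineTrace_mem_richTraces {P : Finset V} {k : ℕ} {e : V × V} (h1 : e.1 ∈ P) (h2 : e.2 ∈ P)
    (h : e.1 ≠ e.2) (hk : k ≤ (lineTrace X Y P e).card) :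
    lineTrace X Y P e ∈ richTraces X Y P k := by
  classical
  exact Finset.mem_filter.2 ⟨Finset.mem_image_of_mem _ (Finset.mem_offDiag.2 ⟨h1, h2, h⟩), hk⟩

open Classical in
variable (X Y) in
/-- The segments between consecutive points of `P` on a line containing at least `k` points
of `P`. -/
def richSegs (P : Finset V) (k : ℕ) : Finset (V × V) :=
  P.offDiag.filter fun e => X e.1 < X e.2 ∧ k ≤ (lineTrace X Y P e).card ∧
    ∀ r ∈ P, X e.1 < X r → X r < X e.2 → segVal X Y e (X r) ≠ Y r

lemma isSegGraph_richSegs (P : Finset V) (k : ℕ) : IsSegGraph X Y P (richSegs X Y P k) := by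
  classical
  intro e he
  simp only [richSegs, Finset.mem_filter, Finset.mem_offDiag] at he
  exact ⟨he.1.1, he.1.2.1, he.2.1, he.2.2.2⟩

lemma segVal_eq_of_lineTrace_eq {P : Finset V} {e f : V × V} (he : X e.1 ≠ X e.2)
    (h1 : e.1 ∈ P) (h2 : e.2 ∈ P) (h : lineTrace X Y P e = lineTrace X Y P f) :
    segVal X Y e = segVal X Y f := by
  classical
  have a1 : e.1 ∈ lineTrace X Y P e := by simp [lineTrace, h1, segVal_fst]
  have a2 : e.2 ∈ lineTrace X Y P e := by simp [lineTrace, h2, segVal_snd he]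
  rw [h] at a1 a2
  exact segVal_eq_of_mem he (Finset.mem_filter.1 a1).2 (Finset.mem_filter.1 a2).2

lemma richSegs_eq_or_disjoint (hX : Function.Injective X) {P : Finset V} {k : ℕ} {e e' : V × V}
    (he : e ∈ richSegs X Y P k) (he' : e' ∈ richSegs X Y P k)
    (h : segVal X Y e = segVal X Y e') :
    e = e' ∨ X e.2 ≤ X e'.1 ∨ X e'.2 ≤ X e.1 := by
  obtain ⟨a1, a2, a3, a4⟩ := isSegGraph_richSegs P k e he
  obtain ⟨b1, b2, b3, b4⟩ := isSegGraph_richSegs P k e' he'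
  by_contra hcon
  push Not at hcon
  obtain ⟨hne, h1, h2⟩ := hcon
  have c1 : ¬ X e.1 < X e'.1 := fun hl => a4 e'.1 b1 hl h1 (by rw [h, segVal_fst])
  have c2 : ¬ X e'.1 < X e.1 := fun hl => b4 e.1 a1 hl h2 (by rw [← h, segVal_fst])
  have c3 : X e.1 = X e'.1 := le_antisymm (not_lt.1 c2) (not_lt.1 c1)
  have c4 : ¬ X e.2 < X e'.2 := fun hl => b4 e.2 a2 h1 hl (by rw [← h, segVal_snd a3.ne])
  have c5 : ¬ X e'.2 < X e.2 := fun hl => a4 e'.2 b2 h2 hl (by rw [h, segVal_snd b3.ne])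
  exact hne (Prod.ext (hX c3) (hX (le_antisymm (not_lt.1 c5) (not_lt.1 c4))))

/-- A point where two given lines cross lies in the interior of at most one segment of each. -/
lemma SegCross.not_disjoint {e f e' f' : V × V} (h : SegCross X Y e f)
    (h' : SegCross X Y e' f') (he : segVal X Y e = segVal X Y e')
    (hf : segVal X Y f = segVal X Y f') : ¬ X e.2 ≤ X e'.1 := by
  intro hle
  obtain ⟨x₁, x₂, ⟨a1, a2⟩, -, ⟨b1, b2⟩, -, h1, h2⟩ := h
  obtain ⟨y₁, y₂, ⟨c1, c2⟩, -, ⟨d1, d2⟩, -, h3, h4⟩ := h'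
  rw [← he, ← hf] at h3 h4
  obtain ⟨m, b, hD⟩ : ∃ m b : ℝ, ∀ x, segVal X Y e x - segVal X Y f x = m * x + b :=
    ⟨segSlope X Y e - segSlope X Y f,
      Y e.1 - segSlope X Y e * X e.1 - (Y f.1 - segSlope X Y f * X f.1),
      fun x => by simp only [segVal]; ring⟩
  have k1 := hD x₁
  have k2 := hD x₂
  have k3 := hD y₁
  have k4 := hD y₂
  have l1 : x₂ ≤ y₁ := by linarith
  have l2 : x₁ ≤ y₂ := by linarith
  rcases le_total 0 m with hm | hm
  · nlinarith [mul_le_mul_of_nonneg_left l1 hm]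
  · nlinarith [mul_le_mul_of_nonpos_left l2 hm]

lemma SegCross.symm {e f : V × V} (h : SegCross X Y e f) : SegCross X Y f e := by
  obtain ⟨x₁, x₂, h1, h2, h3, h4, h5, h6⟩ := h
  exact ⟨x₂, x₁, h4, h3, h2, h1, h6, h5⟩

lemma card_crossPairs_richSegs_le (hX : Function.Injective X) (P : Finset V) (k : ℕ) :
    (crossPairs X Y (richSegs X Y P k)).card ≤ (richTraces X Y P k).card ^ 2 := by
  classical
  rw [sq, ← Finset.card_product]
  refine Finset.card_le_card_of_injOn
    (fun z => (lineTrace X Y P z.1, lineTrace X Y P z.2)) (fun z hz => ?_) ?_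
  · simp only [crossPairs, Finset.coe_filter, Finset.mem_product, Set.mem_ofPred_eq] at hz
    simp only [richSegs, Finset.mem_filter] at hz
    simp only [Finset.coe_product, Set.mem_prod, Finset.mem_coe, richTraces, Finset.mem_filter]
    exact ⟨⟨Finset.mem_image_of_mem _ hz.1.1.1, hz.1.1.2.2.1⟩,
      ⟨Finset.mem_image_of_mem _ hz.1.2.1, hz.1.2.2.2.1⟩⟩
  · rintro ⟨e, f⟩ hz ⟨e', f'⟩ hz' hzz
    simp only [crossPairs, Finset.coe_filter, Finset.mem_product, Set.mem_ofPred_eq] at hz hz'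
    simp only [Prod.mk.injEq] at hzz
    obtain ⟨⟨he, hf⟩, hcr⟩ := hz
    obtain ⟨⟨he', hf'⟩, hcr'⟩ := hz'
    obtain ⟨a1, a2, a3, _⟩ := isSegGraph_richSegs P k e he
    obtain ⟨b1, b2, b3, _⟩ := isSegGraph_richSegs P k f hf
    have ve := segVal_eq_of_lineTrace_eq a3.ne a1 a2 hzz.1
    have vf := segVal_eq_of_lineTrace_eq b3.ne b1 b2 hzz.2
    refine Prod.ext ?_ ?_
    · rcases richSegs_eq_or_disjoint hX he he' ve with h | h | h
      · exact h
      · exact absurd h (hcr.not_disjoint hcr' ve vf)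
      · exact absurd h (hcr'.not_disjoint hcr ve.symm vf.symm)
    · rcases richSegs_eq_or_disjoint hX hf hf' vf with h | h | h
      · exact h
      · exact absurd h (hcr.symm.not_disjoint hcr'.symm vf ve)
      · exact absurd h (hcr'.symm.not_disjoint hcr.symm vf.symm ve.symm)

open Classical in
lemma card_le_card_richSegs_fiber (hX : Function.Injective X) {P : Finset V} {k : ℕ}
    {t : Finset V} (ht : t ∈ richTraces X Y P k) :
    t.card ≤ ((richSegs X Y P k).filter fun e => lineTrace X Y P e = t).card + 1 := by
  simp only [richTraces, Finset.mem_filter, Finset.mem_image, Finset.mem_offDiag] at ht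
  obtain ⟨⟨g, ⟨g1, g2, g3⟩, rfl⟩, hk⟩ := ht
  set t := lineTrace X Y P g with ht
  have hgt : g.1 ∈ t := by simp [ht, lineTrace, g1, segVal_fst]
  obtain ⟨a, hat, ha⟩ := Finset.exists_min_image t X ⟨g.1, hgt⟩
  rw [← Finset.card_erase_add_one hat, Nat.add_le_add_iff_right]
  refine Finset.card_le_card_of_surjOn Prod.snd fun q hq => ?_
  rw [Finset.mem_coe, Finset.mem_erase] at hq
  obtain ⟨p, hp, hpmax⟩ := Finset.exists_max_image (t.filter fun r => X r < X q) X
    ⟨a, Finset.mem_filter.2 ⟨hat, (ha q hq.2).lt_of_ne fun h => hq.1 (hX h).symm⟩⟩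
  rw [Finset.mem_filter] at hp
  have hpP := Finset.mem_filter.1 hp.1
  have hqP := Finset.mem_filter.1 hq.2
  have hv : segVal X Y (p, q) = segVal X Y g := segVal_eq_of_mem hp.2.ne hpP.2 hqP.2
  have htr : lineTrace X Y P (p, q) = t := by
    rw [ht, lineTrace, lineTrace, hv]
  refine ⟨(p, q), ?_, rfl⟩
  rw [Finset.mem_coe, Finset.mem_filter, richSegs, Finset.mem_filter, Finset.mem_offDiag, htr]
  refine ⟨⟨⟨hpP.1, hqP.1, fun h => hp.2.ne (congrArg X h)⟩, hp.2, hk, fun r hr h1 h2 h3 => ?_⟩,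
    rfl⟩
  rw [hv] at h3
  exact absurd (hpmax r (Finset.mem_filter.2 ⟨Finset.mem_filter.2 ⟨hr, h3⟩, h2⟩)) (not_le.2 h1)

/-- The Szemerédi–Trotter bound for the number of incidences between `N` points and the lines
containing at least `k` of them. -/
theorem sum_card_richTraces_le (hX : Function.Injective X) (P : Finset V) {k : ℕ} (hk : 2 ≤ k)
    {N : ℝ} (hN : (P.card : ℝ) ≤ N) (hN0 : 0 < N) :
    ((∑ t ∈ richTraces X Y P k, t.card : ℕ) : ℝ) ≤ max (12 * N) (576 * N ^ 2 / k ^ 2) := by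
  classical
  set L := richTraces X Y P k with hL
  set E := richSegs X Y P k with hE
  have hkL : ∀ t ∈ L, k ≤ t.card := fun t ht => (Finset.mem_filter.1 ht).2
  have hfib : E.card = ∑ t ∈ L, (E.filter fun e => lineTrace X Y P e = t).card := by
    refine Finset.card_eq_sum_card_fiberwise fun e he => ?_
    rw [Finset.mem_coe, hE, richSegs, Finset.mem_filter] at he
    exact Finset.mem_filter.2 ⟨Finset.mem_image_of_mem _ he.1, he.2.2.1⟩
  have hI : ∑ t ∈ L, t.card ≤ 2 * E.card := by
    rw [hfib, Finset.mul_sum]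
    refine Finset.sum_le_sum fun t ht => ?_
    have h1 := card_le_card_richSegs_fiber hX ht
    have h2 := hkL t ht
    rw [← hE] at h1
    omega
  have hLk : L.card * k ≤ 2 * E.card := by
    refine le_trans ?_ hI
    rw [← smul_eq_mul, ← Finset.sum_const]
    exact Finset.sum_le_sum hkL
  have hI' : ((∑ t ∈ L, t.card : ℕ) : ℝ) ≤ 2 * E.card := by exact_mod_cast hI
  by_cases h6 : 6 * N < E.card
  · refine le_max_of_le_right (hI'.trans ?_)
    have hcr := (isSegGraph_richSegs P k).crossing_inequality hX hN hN0 h6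
    have hX2 : ((crossPairs X Y E).card : ℝ) ≤ (L.card : ℝ) ^ 2 := by
      exact_mod_cast card_crossPairs_richSegs_le hX P k
    have hLk' : (L.card : ℝ) * k ≤ 2 * E.card := by exact_mod_cast hLk
    have hk0 : (0 : ℝ) < k := by exact_mod_cast (by omega : 0 < k)
    set e : ℝ := (E.card : ℝ)
    have he : 0 < e := by linarith
    have h1 : e ^ 2 * (e * k ^ 2) ≤ e ^ 2 * (288 * N ^ 2) := by
      calc e ^ 2 * (e * k ^ 2) = e ^ 3 * k ^ 2 := by ring
        _ ≤ 72 * N ^ 2 * (L.card : ℝ) ^ 2 * k ^ 2 := by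
          gcongr
          exact hcr.trans (by gcongr)
        _ = 72 * N ^ 2 * (L.card * k) ^ 2 := by ring
        _ ≤ 72 * N ^ 2 * (2 * e) ^ 2 := by gcongr
        _ = _ := by ring
    have h2 := le_of_mul_le_mul_left h1 (by positivity)
    rw [le_div_iff₀ (by positivity)]
    linarith
  · exact le_max_of_le_left (by linarith)

end Incidence

/-! ### Lattice points on lines -/

/-- The orientation determinant of three lattice points. -/
def latticeDet (p q r : Pt) : ℤ :=
  (q.1 - p.1) * (r.2 - p.2) - (q.2 - p.2) * (r.1 - p.1)

lemma emb_injective : Function.Injective emb := by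
  intro p q h
  simp only [emb, Prod.mk.injEq, Int.cast_inj] at h
  exact Prod.ext h.1 h.2

lemma emb_mem_lineThrough_iff {p q r : Pt} (h : p ≠ q) :
    emb r ∈ lineThrough p q ↔ latticeDet p q r = 0 := by
  have hcast : latticeDet p q r = 0 ↔
      ((q.1 : ℝ) - p.1) * (r.2 - p.2) - (q.2 - p.2) * (r.1 - p.1) = 0 := by
    rw [latticeDet]
    exact_mod_cast Iff.rfl
  rw [hcast]
  simp only [lineThrough, emb, Set.mem_ofPred_eq, Prod.mk_sub_mk, Prod.smul_mk, Prod.mk_add_mk,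
    Prod.mk.injEq, smul_eq_mul]
  constructor
  · rintro ⟨t, h1, h2⟩
    rw [h1, h2]
    ring
  · intro hd
    by_cases h1 : (q.1 : ℝ) - p.1 = 0
    · have h2 : (q.2 : ℝ) - p.2 ≠ 0 := by
        intro h2
        refine h (Prod.ext ?_ ?_)
        · exact_mod_cast (sub_eq_zero.1 h1).symm
        · exact_mod_cast (sub_eq_zero.1 h2).symm
      refine ⟨((r.2 : ℝ) - p.2) / (q.2 - p.2), ?_, ?_⟩
      · rw [h1] at hd ⊢
        have : (r.1 : ℝ) - p.1 = 0 := by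
          rcases mul_eq_zero.1 (show ((q.2 : ℝ) - p.2) * (r.1 - p.1) = 0 by linarith) with h | h
          · exact absurd h h2
          · exact h
        linarith
      · field_simp
        ring
    · refine ⟨((r.1 : ℝ) - p.1) / (q.1 - p.1), ?_, ?_⟩
      · field_simp
        ring
      · field_simp
        linarith

lemma lineCount_eq_card {p q : Pt} (h : p ≠ q) (T : Finset Pt) :
    lineCount (lineThrough p q) T = (T.filter fun r => latticeDet p q r = 0).card := by
  have : lineThrough p q ∩ emb '' (T : Set Pt) =
      emb '' ((T.filter fun r => latticeDet p q r = 0 : Finset Pt) : Set Pt) := by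
    ext x
    constructor
    · rintro ⟨h1, r, hr, rfl⟩
      exact ⟨r, by simpa using ⟨hr, (emb_mem_lineThrough_iff h).1 h1⟩, rfl⟩
    · rintro ⟨r, hr, rfl⟩
      rw [Finset.mem_coe, Finset.mem_filter] at hr
      exact ⟨(emb_mem_lineThrough_iff h).2 hr.2, r, hr.1, rfl⟩
  rw [lineCount, this, Set.ncard_image_of_injective _ emb_injective, Set.ncard_coe_finset]

/-- A linear functional on the plane that is injective on the lattice. -/
def genericX (p : Pt) : ℝ := p.1 + √2 * p.2

lemma genericX_injective : Function.Injective genericX := by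
  intro p q h
  simp only [genericX] at h
  have h2 : p.2 = q.2 := by
    by_contra hne
    have hne' : (p.2 : ℝ) - q.2 ≠ 0 := sub_ne_zero.2 (by exact_mod_cast hne)
    refine irrational_sqrt_two ⟨((q.1 - p.1 : ℤ) : ℚ) / ((p.2 - q.2 : ℤ) : ℚ), ?_⟩
    push_cast
    rw [div_eq_iff hne']
    linarith
  rw [h2, add_left_inj] at h
  exact Prod.ext (by exact_mod_cast h) h2

lemma segVal_genericX_eq_iff {p q : Pt} (h : p ≠ q) (r : Pt) :
    segVal genericX (fun v => (v.2 : ℝ)) (p, q) (genericX r) = r.2 ↔ latticeDet p q r = 0 := by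
  have hX : genericX q - genericX p ≠ 0 := sub_ne_zero.2 fun hc => h (genericX_injective hc).symm
  have hcast : latticeDet p q r = 0 ↔
      ((q.1 : ℝ) - p.1) * (r.2 - p.2) - (q.2 - p.2) * (r.1 - p.1) = 0 := by
    rw [latticeDet]
    exact_mod_cast Iff.rfl
  have hdet : ((q.1 : ℝ) - p.1) * (r.2 - p.2) - (q.2 - p.2) * (r.1 - p.1) =
      (genericX q - genericX p) *
        (r.2 - segVal genericX (fun v => (v.2 : ℝ)) (p, q) (genericX r)) := by
    simp only [segVal, segSlope]
    field_simp
    simp only [genericX]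
    ring
  rw [hcast, hdet, mul_eq_zero, or_iff_right hX, sub_eq_zero, eq_comm]

/-- The traces on `P` of the lines containing at least `k` points of the lattice set `P`. -/
lemma filter_latticeDet_mem_richTraces {P : Finset Pt} {k : ℕ} (hk : 2 ≤ k) {p q : Pt}
    (hp : p ∈ P) (hpq : p ≠ q) (h : k ≤ (P.filter fun r => latticeDet p q r = 0).card) :
    (P.filter fun r => latticeDet p q r = 0) ∈ richTraces genericX (fun v => (v.2 : ℝ)) P k := by
  classical
  obtain ⟨s, hs, hsp⟩ := Finset.exists_mem_ne (hk.trans h) p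
  rw [Finset.mem_filter] at hs
  have hv : segVal genericX (fun v => (v.2 : ℝ)) (p, s) =
      segVal genericX (fun v => (v.2 : ℝ)) (p, q) := by
    refine segVal_eq_of_mem (fun hc => hsp (genericX_injective hc).symm)
      ((segVal_genericX_eq_iff hpq _).2 (by simp [latticeDet]))
      ((segVal_genericX_eq_iff hpq _).2 hs.2)
  have ht : lineTrace genericX (fun v => (v.2 : ℝ)) P (p, s) =
      P.filter fun r => latticeDet p q r = 0 := by
    rw [lineTrace, hv]
    ext r
    simp only [Finset.mem_filter, segVal_genericX_eq_iff hpq]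
  rw [← ht] at h ⊢
  exact lineTrace_mem_richTraces (e := (p, s)) hp hs.1 hsp.symm h

/-- Two vectors parallel to a nonzero lattice vector are parallel to each other. -/
lemma cross_eq_zero_of_cross {u v w : Pt} (hu : u ≠ 0) (hv : u.1 * v.2 - u.2 * v.1 = 0)
    (hw : u.1 * w.2 - u.2 * w.1 = 0) : v.1 * w.2 - v.2 * w.1 = 0 := by
  by_cases h1 : u.1 = 0
  · have h2 : u.2 ≠ 0 := fun h2 => hu (Prod.ext h1 h2)
    refine (mul_eq_zero.1 (?_ : u.2 * _ = 0)).resolve_left h2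
    linear_combination v.2 * hw - w.2 * hv
  · refine (mul_eq_zero.1 (?_ : u.1 * _ = 0)).resolve_left h1
    linear_combination v.1 * hw - w.1 * hv

/-- A lattice vector orthogonal to a nonzero vector `v` that is parallel to a nonzero vector `u` is
orthogonal to `u`. -/
lemma dot_eq_zero_of_cross {u v w : Pt} (hv : v ≠ 0) (huv : u.1 * v.2 - u.2 * v.1 = 0)
    (hvw : v.1 * w.1 + v.2 * w.2 = 0) : u.1 * w.1 + u.2 * w.2 = 0 := by
  by_cases h1 : v.1 = 0
  · have h2 : v.2 ≠ 0 := fun h2 => hv (Prod.ext h1 h2)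
    refine (mul_eq_zero.1 (?_ : v.2 * _ = 0)).resolve_left h2
    linear_combination w.1 * huv + u.2 * hvw
  · refine (mul_eq_zero.1 (?_ : v.1 * _ = 0)).resolve_left h1
    linear_combination u.1 * hvw - w.2 * huv

/-- Two vectors orthogonal to the same nonzero lattice vector are parallel. -/
lemma cross_eq_zero_of_dot {u v w : Pt} (hu : u ≠ 0) (hv : u.1 * v.1 + u.2 * v.2 = 0)
    (hw : u.1 * w.1 + u.2 * w.2 = 0) : v.1 * w.2 - v.2 * w.1 = 0 := by
  have := cross_eq_zero_of_cross (u := (-u.2, u.1)) (v := v) (w := w)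
    (fun h => hu (Prod.ext (by simpa using congrArg Prod.snd h)
      (by simpa using congrArg Prod.fst h))) (by simp only; linarith) (by simp only; linarith)
  exact this

/-! ### Counting rectangles -/

lemma IsRect.dot_second {Q : Quad} (h : IsRect Q) :
    ((Q 0).1 - (Q 1).1) * ((Q 2).1 - (Q 1).1) + ((Q 0).2 - (Q 1).2) * ((Q 2).2 - (Q 1).2) = 0 := by
  obtain ⟨hp, hd⟩ := h
  have h1 := congrArg Prod.fst hp
  have h2 := congrArg Prod.snd hp
  simp only [Prod.fst_add, Prod.snd_add] at h1 h2
  rw [dotQ] at hd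
  linear_combination (-1) * hd + ((Q 0).1 - (Q 1).1) * h1 + ((Q 0).2 - (Q 1).2) * h2

lemma QZeroJA.count_lt {S : ℕ → Finset Pt} {j a : Fin 4 → ℕ} {Q : Quad} (hQ : Q ∈ QZeroJA S j a) :
    ((S (j 1)).filter fun r => latticeDet (Q 1) (Q 0) r = 0).card < 2 ^ (a 1 + 1) ∧
    ((S (j 2)).filter fun r => latticeDet (Q 2) (Q 1) r = 0).card < 2 ^ (a 2 + 1) := by
  obtain ⟨_, hinj, _, hcount⟩ := hQ
  constructor
  · have h := (max_lt_iff.1 (hcount 1).2).2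
    rw [show (1 : Fin 4) - 1 = 0 from rfl, lineCount_eq_card (hinj.ne (by decide))] at h
    exact h
  · have h := (max_lt_iff.1 (hcount 2).2).2
    rw [show (2 : Fin 4) - 1 = 1 from rfl, lineCount_eq_card (hinj.ne (by decide))] at h
    exact h

/-- Rectangles with a common first vertex, whose first sides lie on a common line, are determined
by the second and third vertices, which lie on prescribed lines. -/
lemma card_le_of_common_side {S : ℕ → Finset Pt} {j a : Fin 4 → ℕ} (G : Finset Quad)
    (hG : ∀ Q ∈ G, Q ∈ QZeroJA S j a) (h0 : ∀ Q ∈ G, ∀ Q' ∈ G, Q 0 = Q' 0)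
    (h1 : ∀ Q ∈ G, ∀ Q' ∈ G, latticeDet (Q 0) (Q 1) (Q' 1) = 0) :
    G.card ≤ 2 ^ (a 2 + 1) * 2 ^ (a 1 + 1) := by
  classical
  rcases G.eq_empty_or_nonempty with rfl | ⟨R, hR⟩
  · simp
  have himg : (G.image fun Q => Q 1).card ≤ 2 ^ (a 1 + 1) := by
    refine le_trans (Finset.card_le_card fun v hv => ?_) (QZeroJA.count_lt (hG R hR)).1.le
    obtain ⟨Q, hQ, rfl⟩ := Finset.mem_image.1 hv
    refine Finset.mem_filter.2 ⟨(hG Q hQ).2.2.1 1, ?_⟩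
    have := h1 R hR Q hQ
    simp only [latticeDet] at this ⊢
    linarith
  refine le_trans (Finset.card_le_mul_card_image (f := fun Q : Quad => Q 1) G (2 ^ (a 2 + 1))
    fun v hv => ?_) (Nat.mul_le_mul_left _ himg)
  obtain ⟨R', hR', rfl⟩ := Finset.mem_image.1 hv
  refine le_trans (Finset.card_le_card_of_injOn (fun Q => Q 2) (fun Q hQ => ?_) ?_)
    (QZeroJA.count_lt (hG R' hR')).2.le
  · rw [Finset.mem_coe, Finset.mem_filter] at hQ
    obtain ⟨hQ, hQ1⟩ := hQ
    refine Finset.mem_filter.2 ⟨(hG Q hQ).2.2.1 2, ?_⟩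
    have d1 := (hG Q hQ).1.dot_second
    have d2 := (hG R' hR').1.dot_second
    rw [h0 Q hQ R' hR', hQ1] at d1
    have hne : R' 0 - R' 1 ≠ 0 := sub_ne_zero.2 ((hG R' hR').2.1.ne (by decide))
    have := cross_eq_zero_of_dot (v := Q 2 - R' 1) (w := R' 2 - R' 1) hne d1 d2
    simp only [Prod.fst_sub, Prod.snd_sub] at this
    simp only [latticeDet]
    linarith
  · intro Q hQ Q' hQ' h2
    rw [Finset.mem_coe, Finset.mem_filter] at hQ hQ'
    have e0 := h0 Q hQ.1 Q' hQ'.1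
    have e1 : Q 1 = Q' 1 := hQ.2.trans hQ'.2.symm
    have e2 : Q 2 = Q' 2 := h2
    have e3 : Q 3 = Q' 3 := by
      have p1 : Q 0 + Q 2 = Q 1 + Q 3 := (hG Q hQ.1).1.1
      have p2 : Q' 0 + Q' 2 = Q' 1 + Q' 3 := (hG Q' hQ'.1).1.1
      rw [e0, e1, e2, p2] at p1
      exact Eq.symm <| add_left_cancel p1
    funext i
    fin_cases i
    exacts [e0, e1, e2, e3]

lemma QZeroJA.finite (S : ℕ → Finset Pt) (j a : Fin 4 → ℕ) : (QZeroJA S j a).Finite :=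
  (Set.Finite.pi' fun k => (S (j k)).finite_toSet).subset fun _ hQ k => hQ.2.2.1 k

/-- The rectangles for which the line through the first vertex and its neighbour `Q i` is rich. -/
lemma card_filter_rich_side_le {S : ℕ → Finset Pt} {j a : Fin 4 → ℕ} (ha : 1 ≤ a 0) {i : Fin 4}
    (hi : i = 1 ∨ i = 3) (F : Finset Quad) (hF : ∀ Q ∈ F, Q ∈ QZeroJA S j a ∧
      2 ^ a 0 ≤ ((S (j 0)).filter fun r => latticeDet (Q 0) (Q i) r = 0).card) :
    F.card ≤ 2 ^ (a 2 + 1) * 2 ^ (a 1 + 1) *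
      ∑ t ∈ richTraces genericX (fun v => (v.2 : ℝ)) (S (j 0)) (2 ^ a 0), t.card := by
  classical
  have hk : 2 ≤ 2 ^ a 0 := by
    calc 2 = 2 ^ 1 := rfl
      _ ≤ 2 ^ a 0 := Nat.pow_le_pow_right (by norm_num) ha
  have hi0 : (0 : Fin 4) ≠ i := by rcases hi with rfl | rfl <;> decide
  rw [← Finset.card_sigma (richTraces genericX (fun v => (v.2 : ℝ)) (S (j 0)) (2 ^ a 0))
    (fun t => t)]
  refine Finset.card_le_mul_card_image_of_maps_to
    (f := fun Q : Quad => (⟨(S (j 0)).filter fun r => latticeDet (Q 0) (Q i) r = 0, Q 0⟩ :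
      (_ : Finset Pt) × Pt)) (fun Q hQ => ?_) _ ?_
  · obtain ⟨hQ1, hQ2⟩ := hF Q hQ
    rw [Finset.mem_sigma]
    exact ⟨filter_latticeDet_mem_richTraces hk (hQ1.2.2.1 0) (hQ1.2.1.ne hi0) hQ2,
      Finset.mem_filter.2 ⟨hQ1.2.2.1 0, by simp [latticeDet]⟩⟩
  rintro ⟨t, ξ⟩ ht
  obtain ⟨htr, hξ⟩ := Finset.mem_sigma.1 ht
  obtain ⟨η, hη, hne⟩ := Finset.exists_mem_ne (hk.trans (Finset.mem_filter.1 htr).2) ξ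
  have hne' : η - ξ ≠ 0 := sub_ne_zero.2 hne
  have hmem : ∀ Q ∈ F.filter (fun Q : Quad =>
      (⟨(S (j 0)).filter fun r => latticeDet (Q 0) (Q i) r = 0, Q 0⟩ :
        (_ : Finset Pt) × Pt) = ⟨t, ξ⟩),
      Q ∈ QZeroJA S j a ∧ Q 0 = ξ ∧ latticeDet ξ (Q i) η = 0 := by
    intro Q hQ
    rw [Finset.mem_filter, Sigma.mk.injEq, heq_eq_eq] at hQ
    obtain ⟨hQF, hQt, hQ0⟩ := hQ
    rw [← hQt] at hη
    have := (Finset.mem_filter.1 hη).2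
    rw [hQ0] at this
    exact ⟨(hF Q hQF).1, hQ0, this⟩
  refine card_le_of_common_side _ (fun Q hQ => (hmem Q hQ).1)
    (fun Q hQ Q' hQ' => (hmem Q hQ).2.1.trans (hmem Q' hQ').2.1.symm) fun Q hQ Q' hQ' => ?_
  obtain ⟨hQ1, hQ2, hQ3⟩ := hmem Q hQ
  obtain ⟨hQ1', hQ2', hQ3'⟩ := hmem Q' hQ'
  rw [hQ2]
  rcases hi with rfl | rfl
  · refine cross_eq_zero_of_cross (v := Q 1 - ξ) (w := Q' 1 - ξ) hne' ?_ ?_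
    · simp only [latticeDet, Prod.fst_sub, Prod.snd_sub] at hQ3 ⊢
      linarith
    · simp only [latticeDet, Prod.fst_sub, Prod.snd_sub] at hQ3' ⊢
      linarith
  · have key : ∀ R ∈ QZeroJA S j a, R 0 = ξ → latticeDet ξ (R 3) η = 0 →
        (η - ξ).1 * (R 1 - ξ).1 + (η - ξ).2 * (R 1 - ξ).2 = 0 := by
      intro R hR hR0 hR3
      have hd := hR.1.2
      refine dot_eq_zero_of_cross (v := R 3 - ξ)
        (sub_ne_zero.2 (hR0 ▸ hR.2.1.ne (by decide))) ?_ ?_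
      · simp only [latticeDet, Prod.fst_sub, Prod.snd_sub] at hR3 ⊢
        linarith
      · simp only [dotQ, hR0, Prod.fst_sub, Prod.snd_sub] at hd ⊢
        linarith
    exact cross_eq_zero_of_dot (v := Q 1 - ξ) (w := Q' 1 - ξ) hne'
      (key Q hQ1 hQ2 hQ3) (key Q' hQ1' hQ2' hQ3')

/-- The rectangle count in terms of the incidences between `S (j 0)` and its rich lines. -/
lemma QZeroJA.ncard_le (S : ℕ → Finset Pt) (j a : Fin 4 → ℕ) (ha : 1 ≤ a 0) :
    (QZeroJA S j a).ncard ≤ 8 * (2 ^ a 1 * 2 ^ a 2) *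
      ∑ t ∈ richTraces genericX (fun v => (v.2 : ℝ)) (S (j 0)) (2 ^ a 0), t.card := by
  classical
  set F := (QZeroJA.finite S j a).toFinset with hF
  have hmem : ∀ Q, Q ∈ F ↔ Q ∈ QZeroJA S j a := fun Q => Set.Finite.mem_toFinset _
  let rich : Fin 4 → Quad → Prop := fun i Q =>
    2 ^ a 0 ≤ ((S (j 0)).filter fun r => latticeDet (Q 0) (Q i) r = 0).card
  have hsub : F ⊆ F.filter (rich 1) ∪ F.filter (rich 3) := by
    intro Q hQ
    obtain ⟨_, hinj, _, hcount⟩ := (hmem Q).1 hQ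
    have h := le_max_iff.1 (hcount 0).1
    rw [show (0 : Fin 4) + 1 = 1 from rfl, show (0 : Fin 4) - 1 = 3 from rfl,
      lineCount_eq_card (hinj.ne (by decide)), lineCount_eq_card (hinj.ne (by decide))] at h
    rw [Finset.mem_union, Finset.mem_filter, Finset.mem_filter]
    exact h.imp (fun h => ⟨hQ, h⟩) (fun h => ⟨hQ, h⟩)
  have hside : ∀ i : Fin 4, i = 1 ∨ i = 3 → (F.filter (rich i)).card ≤ _ := fun i hi =>
    card_filter_rich_side_le ha hi (F.filter (rich i)) fun Q hQ =>
      ⟨(hmem Q).1 (Finset.mem_filter.1 hQ).1, (Finset.mem_filter.1 hQ).2⟩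
  rw [Set.ncard_eq_toFinset_card _ (QZeroJA.finite S j a), ← hF]
  calc F.card ≤ (F.filter (rich 1)).card + (F.filter (rich 3)).card :=
        (Finset.card_le_card hsub).trans (Finset.card_union_le _ _)
    _ ≤ _ := Nat.add_le_add (hside 1 (Or.inl rfl)) (hside 3 (Or.inr rfl))
    _ = _ := by ring

/-- **Estimate (3.10) of Lemma 3.5.** If `1 ≤ a₁ < j₁/2 + C` then
`#𝒬⁰(j⃗,a⃗) ≲ 2^{2j₁ − 2a₁ + a₂ + a₃}`. -/
theorem QZeroJA_count_a2_a3 (C : ℕ) :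
    ∃ c : ℝ, 0 < c ∧
      ∀ (m : ℕ) (S : ℕ → Finset Pt),
        1 ≤ m →
        (∀ i ≤ m, ∀ j ≤ m, i ≠ j → Disjoint (S i) (S j)) →
        (∀ j ≤ m, (S j).card ≤ 2 ^ j) →
        ∀ j a : Fin 4 → ℕ, (∀ k, j k ≤ m) →
          1 ≤ a 0 → (a 0 : ℝ) < (j 0 : ℝ) / 2 + (C : ℝ) →
          ((QZeroJA S j a).ncard : ℝ) ≤
            c * (2 : ℝ) ^ (2 * (j 0 : ℝ) - 2 * (a 0 : ℝ) + (a 1 : ℝ) + (a 2 : ℝ)) := by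
  refine ⟨4608 * (2 : ℝ) ^ (2 * C), by positivity, ?_⟩
  intro m S _ _ hcard j a hj ha0 haC
  set I := ∑ t ∈ richTraces genericX (fun v => (v.2 : ℝ)) (S (j 0)) (2 ^ a 0), t.card
  set N : ℝ := 2 ^ j 0 with hN
  set K : ℝ := 2 ^ a 0 with hK
  have hN0 : 0 < N := by positivity
  have hK0 : 0 < K := by positivity
  have hI : (I : ℝ) ≤ max (12 * N) (576 * N ^ 2 / K ^ 2) := by
    have h := sum_card_richTraces_le (Y := fun v : Pt => (v.2 : ℝ)) genericX_injective (S (j 0))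
      (k := 2 ^ a 0) (N := N) (Nat.pow_le_pow_right (by norm_num) ha0 : 2 ^ 1 ≤ 2 ^ a 0)
      (by rw [hN]; exact_mod_cast hcard _ (hj 0)) hN0
    simpa only [Nat.cast_pow, Nat.cast_ofNat] using h
  have hKN : K ^ 2 ≤ 2 ^ (2 * C) * N := by
    rw [hK, hN, ← pow_mul, ← pow_add]
    refine pow_le_pow_right₀ (by norm_num) ?_
    have : ((a 0 * 2 : ℕ) : ℝ) ≤ ((2 * C + j 0 : ℕ) : ℝ) := by
      push_cast
      linarith
    exact_mod_cast this
  have hC1 : (1 : ℝ) ≤ 2 ^ (2 * C) := one_le_pow₀ (by norm_num)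
  have hI' : (I : ℝ) ≤ 576 * 2 ^ (2 * C) * (N ^ 2 / K ^ 2) := by
    refine hI.trans (max_le ?_ ?_)
    · rw [← mul_div_assoc, le_div_iff₀ (by positivity)]
      nlinarith [mul_le_mul_of_nonneg_left hKN hN0.le,
        mul_pos (zero_lt_one.trans_le hC1) (pow_pos hN0 2)]
    · have : 0 ≤ N ^ 2 / K ^ 2 := by positivity
      rw [mul_div_assoc]
      nlinarith
  have hpow : (2 : ℝ) ^ (2 * (j 0 : ℝ) - 2 * (a 0 : ℝ) + (a 1 : ℝ) + (a 2 : ℝ)) =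
      N ^ 2 / K ^ 2 * 2 ^ a 1 * 2 ^ a 2 := by
    rw [Real.rpow_add two_pos, Real.rpow_add two_pos, Real.rpow_sub two_pos, Real.rpow_natCast,
      Real.rpow_natCast, mul_comm 2 (j 0 : ℝ), mul_comm 2 (a 0 : ℝ), Real.rpow_mul two_pos.le,
      Real.rpow_mul two_pos.le, Real.rpow_natCast, Real.rpow_natCast, Real.rpow_two,
      Real.rpow_two]
  calc ((QZeroJA S j a).ncard : ℝ) ≤ 8 * (2 ^ a 1 * 2 ^ a 2) * (I : ℝ) := by
        exact_mod_cast QZeroJA.ncard_le S j a ha0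
    _ ≤ 8 * (2 ^ a 1 * 2 ^ a 2) * (576 * 2 ^ (2 * C) * (N ^ 2 / K ^ 2)) := by gcongr
    _ = _ := by
        rw [hpow]
        ring
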